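/- Let N ≥ 1, let S ⊆ ℤ/Nℤ and Ω ⊆ ℤ/Nℤ. Assume the dual certificate condition: for every family (λ_t)_{t∈S} of complex numbers of modulus 1, there exists P : ℤ/Nℤ → ℂ whose Fourier transform P̂ is supported in Ω (equivalently, P is a linear combination of the characters t ↦ e^{2πiωt/N}, ω ∈ Ω), such that |P(t) − λ_t| < 1/2 for all t ∈ S and |P(t)| < 1/2 for all t ∉ S. Then every z : ℤ/Nℤ → ℂ, not identically zero, with ẑ(ω) = 0 for all ω ∈ Ω, satisfies ∑_{t∉S}|z(t)| > ∑_{t∈S}|z(t)|. -/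

import Mathlib

/-- Discrete Fourier transform on `ℤ/Nℤ`:
`ẑ(ω) = ∑_{t ∈ ℤ/Nℤ} z(t) · e^{-2πiωt/N}`. -/
noncomputable def dft {N : ℕ} [NeZero N] (z : ZMod N → ℂ) (ω : ZMod N) : ℂ :=
  ∑ t : ZMod N,
    z t * Complex.exp (-(2 * Real.pi * Complex.I * (ω.val * t.val)) / N)

theorem dft_eq_zmodDFT {N : ℕ} [NeZero N] (z : ZMod N → ℂ) (ω : ZMod N) :
    dft z ω = ZMod.dft z ω := by
  rw [dft, ZMod.dft_apply]
  refine Finset.sum_congr rfl fun t _ => ?_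
  have h : -(t * ω) = ((-((ω.val : ℤ) * (t.val : ℤ)) : ℤ) : ZMod N) := by
    push_cast
    simp only [ZMod.natCast_zmod_val]
    ring
  rw [h, ZMod.stdAddChar_coe, smul_eq_mul, mul_comm]
  congr 2
  push_cast
  ring

/-- Parseval's identity on `ℤ/Nℤ`. -/
theorem sum_dft_mul_conj_dft {N : ℕ} [NeZero N] (P z : ZMod N → ℂ) :
    ∑ ω, dft P ω * starRingEnd ℂ (dft z ω) = N * ∑ t, P t * starRingEnd ℂ (z t) := by
  have hinv (t : ZMod N) : ∑ ω, ZMod.stdAddChar (ω * t) * ZMod.dft P ω = N * P t := by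
    have h := ZMod.invDFT_apply (ZMod.dft P) t
    rw [LinearEquiv.symm_apply_apply] at h
    simp only [smul_eq_mul] at h
    rw [h, mul_inv_cancel_left₀ (NeZero.ne _)]
  simp only [dft_eq_zmodDFT, Finset.mul_sum, ← mul_assoc, ← hinv]
  simp only [ZMod.dft_apply z, map_sum, Finset.mul_sum, Finset.sum_mul]
  rw [Finset.sum_comm]
  refine Finset.sum_congr rfl fun t _ => Finset.sum_congr rfl fun ω _ => ?_
  rw [smul_eq_mul, map_mul, ← AddChar.map_neg_eq_conj, neg_neg, mul_comm t ω]
  ring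

/-- The dual certificate condition: if for every choice of unimodular signs
`(λ_t)_{t∈S}` there is a trigonometric polynomial `P` with frequencies in `Ω` such
that `|P(t) − λ_t| < 1/2` on `S` and `|P(t)| < 1/2` off `S`, then every nonzero `z`
with `ẑ = 0` on `Ω` satisfies `∑_{t∉S}|z(t)| > ∑_{t∈S}|z(t)|`. -/
theorem stmt_14 (N : ℕ) [NeZero N] (hN : 1 ≤ N) (S Ω : Finset (ZMod N))
    (hcert : ∀ lam : ZMod N → ℂ, (∀ t ∈ S, ‖lam t‖ = 1) →
      ∃ P : ZMod N → ℂ, (∀ ω ∉ Ω, dft P ω = 0) ∧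
        (∀ t ∈ S, ‖P t - lam t‖ < 1 / 2) ∧ (∀ t ∉ S, ‖P t‖ < 1 / 2))
    (z : ZMod N → ℂ) (hz0 : z ≠ 0) (hzΩ : ∀ ω ∈ Ω, dft z ω = 0) :
    (∑ t ∈ S, ‖z t‖) < ∑ t ∈ Sᶜ, ‖z t‖ := by
  obtain ⟨lam, hlam, hlamz⟩ : ∃ lam : ZMod N → ℂ, (∀ t, ‖lam t‖ = 1) ∧
      ∀ t, lam t * starRingEnd ℂ (z t) = ‖z t‖ := by
    have (t : ZMod N) : ∃ l : ℂ, ‖l‖ = 1 ∧ l * starRingEnd ℂ (z t) = ‖z t‖ := by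
      by_cases h : z t = 0
      · exact ⟨1, by simp [h]⟩
      · have h' : (‖z t‖ : ℂ) ≠ 0 := by simpa using h
        refine ⟨z t / ‖z t‖, by simp [h], ?_⟩
        rw [div_mul_eq_mul_div, Complex.mul_conj', div_eq_iff h', sq]
    choose lam h using this
    exact ⟨lam, fun t => (h t).1, fun t => (h t).2⟩
  obtain ⟨P, hP, hPS, hPSc⟩ := hcert lam fun t _ => hlam t
  have horth : ∑ t, P t * starRingEnd ℂ (z t) = 0 := by
    have h : (N : ℂ) * ∑ t, P t * starRingEnd ℂ (z t) = 0 := by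
      rw [← sum_dft_mul_conj_dft]
      refine Finset.sum_eq_zero fun ω _ => ?_
      by_cases hω : ω ∈ Ω
      · simp [hzΩ ω hω]
      · simp [hP ω hω]
    exact (mul_eq_zero.1 h).resolve_left (NeZero.ne _)
  let r : ZMod N → ℂ := fun t => (if t ∈ S then lam t else 0) - P t
  have hr (t : ZMod N) : ‖r t‖ < 1 / 2 := by
    by_cases h : t ∈ S
    · simpa [r, h, norm_sub_rev] using hPS t h
    · simpa [r, h] using hPSc t h
  have hsum : ((∑ t ∈ S, ‖z t‖ : ℝ) : ℂ) = ∑ t, r t * starRingEnd ℂ (z t) := by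
    simp only [r, sub_mul, Finset.sum_sub_distrib, horth, sub_zero, ite_mul, zero_mul, hlamz]
    simp
  have hle : ∑ t ∈ S, ‖z t‖ ≤ ∑ t, ‖r t‖ * ‖z t‖ := by
    calc ∑ t ∈ S, ‖z t‖ = ‖((∑ t ∈ S, ‖z t‖ : ℝ) : ℂ)‖ := by
          rw [Complex.norm_of_nonneg (by positivity)]
      _ ≤ ∑ t, ‖r t * starRingEnd ℂ (z t)‖ := hsum ▸ norm_sum_le _ _
      _ = ∑ t, ‖r t‖ * ‖z t‖ := by simp
  have hlt : ∑ t, ‖r t‖ * ‖z t‖ < ∑ t, 1 / 2 * ‖z t‖ := by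
    obtain ⟨t, ht⟩ := Function.ne_iff.1 hz0
    exact Finset.sum_lt_sum (fun t _ => by gcongr; exact (hr t).le)
      ⟨t, Finset.mem_univ t, mul_lt_mul_of_pos_right (hr t) (norm_pos_iff.2 ht)⟩
  rw [← Finset.mul_sum, ← Finset.sum_add_sum_compl S fun t => ‖z t‖] at hlt
  linarith
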